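/- For every real number x with π/4 < x < π/2, one has π/2 − x < cot x < (π/2 − x) + (π/2 − x)². -/

import Mathlib

open Real

lemma tan_lt_add_sq {t : ℝ} (h0 : 0 < t) (h1 : t < 1) : tan t < t + t ^ 2 := by
  have hcos : 1 - t ^ 2 / 2 < cos t := one_sub_sq_div_two_lt_cos h0.ne'
  have hpos : 0 < cos t := by nlinarith
  rw [tan_eq_sin_div_cos, div_lt_iff₀ hpos]
  calc
    sin t < t := sin_lt h0
    _ ≤ (t + t ^ 2) * (1 - t ^ 2 / 2) := by
      have : 0 ≤ t ^ 2 * ((1 - t) * (2 + t)) :=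
        mul_nonneg (sq_nonneg t) (mul_nonneg (by linarith) (by linarith))
      nlinarith
    _ ≤ (t + t ^ 2) * cos t := by gcongr

/-- Two-sided polynomial bounds on the cotangent near `π/2`:
for `π/4 < x < π/2`, `π/2 − x < cot x < (π/2 − x) + (π/2 − x)²`. -/
theorem cot_bounds_near_pi_div_two (x : ℝ) (h1 : π / 4 < x) (h2 : x < π / 2) :
    π / 2 - x < Real.cot x ∧ Real.cot x < (π / 2 - x) + (π / 2 - x) ^ 2 := by
  have hcot : Real.cot x = tan (π / 2 - x) := by
    rw [tan_eq_sin_div_cos, sin_pi_div_two_sub, cos_pi_div_two_sub, Real.cot_eq_cos_div_sin]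
  have hpi := pi_pos
  rw [hcot]
  exact ⟨lt_tan (by linarith) (by linarith),
    tan_lt_add_sq (by linarith) (by linarith [pi_lt_four])⟩
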